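/- All symbols interpreted in a consistent state are relevant: if (S_obs, S_dec) is a consistent state, then every symbol interpreted in the state (by S_obs or S_dec) is interpreted in some ≤_p-minimal definite state expanding the state; in particular the set of ≤_p-minimal definite states expanding a consistent state is nonempty. -/

import Mathlib

/-- A partial structure assigns an optional Boolean value to each symbol. -/
abbrev PartialStruct (α : Type*) := α → Option Bool

/-- A total structure assigns a Boolean value to each symbol. -/
abbrev TotalStruct (α : Type*) := α → Bool

/-- `Lep S S'` : `S` is less precise than `S'`. -/
def Lep {α : Type*} (S S' : PartialStruct α) : Prop :=
  ∀ σ v, S σ = some v → S' σ = some v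

/-- `Expands M S` : the total structure `M` is a total expansion of `S`. -/
def Expands {α : Type*} (M : TotalStruct α) (S : PartialStruct α) : Prop :=
  ∀ σ v, S σ = some v → M σ = v

section States
variable {ε δ : Type*}

/-- A state is consistent if some joint total expansion is a model of both theories. -/
def Consistent (Tenv : Set (TotalStruct ε)) (Tsol : Set (TotalStruct ε × TotalStruct δ))
    (Sobs : PartialStruct ε) (Sdec : PartialStruct δ) : Prop :=
  ∃ So Sd, Expands So Sobs ∧ Expands Sd Sdec ∧ So ∈ Tenv ∧ (So, Sd) ∈ Tsol

/-- A definite state. -/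
def Definite (Tenv : Set (TotalStruct ε)) (Tsol : Set (TotalStruct ε × TotalStruct δ))
    (Sobs : PartialStruct ε) (Sdec : PartialStruct δ) : Prop :=
  ∀ So, Expands So Sobs → So ∈ Tenv → ∀ Sd, Expands Sd Sdec → (So, Sd) ∈ Tsol

/-- A contingent state. -/
def Contingent (Tenv : Set (TotalStruct ε)) (Tsol : Set (TotalStruct ε × TotalStruct δ))
    (Sobs : PartialStruct ε) (Sdec : PartialStruct δ) : Prop :=
  ∀ So, Expands So Sobs → So ∈ Tenv → ∃ Sd, Expands Sd Sdec ∧ (So, Sd) ∈ Tsol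

end States

section Minimal
variable {ε δ : Type*}

/-- The set of `≤ₚ`-minimal definite states expanding a given state. -/
def MinDef (Tenv : Set (TotalStruct ε)) (Tsol : Set (TotalStruct ε × TotalStruct δ))
    (Sobs : PartialStruct ε) (Sdec : PartialStruct δ) :
    Set (PartialStruct ε × PartialStruct δ) :=
  {p | Definite Tenv Tsol p.1 p.2 ∧ Lep Sobs p.1 ∧ Lep Sdec p.2 ∧
       ∀ q : PartialStruct ε × PartialStruct δ,
         Definite Tenv Tsol q.1 q.2 → Lep Sobs q.1 → Lep Sdec q.2 →
         Lep q.1 p.1 → Lep q.2 p.2 → q = p}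

/-- The set of `≤ₚ`-minimal contingent states expanding a given state. -/
def MinCont (Tenv : Set (TotalStruct ε)) (Tsol : Set (TotalStruct ε × TotalStruct δ))
    (Sobs : PartialStruct ε) (Sdec : PartialStruct δ) :
    Set (PartialStruct ε × PartialStruct δ) :=
  {p | Contingent Tenv Tsol p.1 p.2 ∧ Lep Sobs p.1 ∧ Lep Sdec p.2 ∧
       ∀ q : PartialStruct ε × PartialStruct δ,
         Contingent Tenv Tsol q.1 q.2 → Lep Sobs q.1 → Lep Sdec q.2 →
         Lep q.1 p.1 → Lep q.2 p.2 → q = p}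

end Minimal

theorem Lep.trans {α : Type*} {S T U : PartialStruct α} (h : Lep S T) (h' : Lep T U) :
    Lep S U := fun σ v hv => h' σ v (h σ v hv)

theorem Lep.antisymm {α : Type*} {S T : PartialStruct α} (h : Lep S T) (h' : Lep T S) :
    S = T :=
  funext fun σ => Option.ext fun v => ⟨h σ v, h' σ v⟩

theorem Lep.isSome {α : Type*} {S T : PartialStruct α} (h : Lep S T) {σ : α}
    (hσ : (S σ).isSome) : (T σ).isSome := by
  obtain ⟨v, hv⟩ := Option.isSome_iff_exists.mp hσ
  exact Option.isSome_iff_exists.mpr ⟨v, h σ v hv⟩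

/-- A total structure, viewed as a partial structure, has only itself as a total expansion. -/
theorem Expands.eq_of_some {α : Type*} {M N : TotalStruct α}
    (h : Expands M fun σ => some (N σ)) : M = N :=
  funext fun σ => h σ (N σ) rfl

theorem Expands.lep_some {α : Type*} {M : TotalStruct α} {S : PartialStruct α}
    (h : Expands M S) : Lep S fun σ => some (M σ) :=
  fun σ v hv => congrArg some (h σ v hv)

theorem Consistent.minDef_nonempty {ε δ : Type*} [Finite ε] [Finite δ]
    {Tenv : Set (TotalStruct ε)} {Tsol : Set (TotalStruct ε × TotalStruct δ)}
    {Sobs : PartialStruct ε} {Sdec : PartialStruct δ}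
    (hcons : Consistent Tenv Tsol Sobs Sdec) : (MinDef Tenv Tsol Sobs Sdec).Nonempty := by
  obtain ⟨So, Sd, ho, hd, -, hsol⟩ := hcons
  let D : Set (PartialStruct ε × PartialStruct δ) :=
    {p | Definite Tenv Tsol p.1 p.2 ∧ Lep Sobs p.1 ∧ Lep Sdec p.2}
  have hne : D.Nonempty := by
    refine ⟨(fun σ => some (So σ), fun σ => some (Sd σ)), ?_, ho.lep_some, hd.lep_some⟩
    intro M hM _ N hN
    rwa [hM.eq_of_some, hN.eq_of_some]
  let : LE (PartialStruct ε × PartialStruct δ) := ⟨fun p q => Lep p.1 q.1 ∧ Lep p.2 q.2⟩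
  have : IsTrans (PartialStruct ε × PartialStruct δ) (· ≥ ·) :=
    ⟨fun _ _ _ h h' => ⟨h'.1.trans h.1, h'.2.trans h.2⟩⟩
  obtain ⟨p, hp⟩ := D.toFinite.exists_minimal hne
  refine ⟨p, hp.prop.1, hp.prop.2.1, hp.prop.2.2, fun q hq hqo hqd h₁ h₂ => ?_⟩
  have h := hp.le_of_le (y := q) ⟨hq, hqo, hqd⟩ ⟨h₁, h₂⟩
  exact Prod.ext (h₁.antisymm h.1) (h₂.antisymm h.2)

/-- All symbols interpreted in a consistent state are relevant; in particular the
set of minimal definite expansions of a consistent state is nonempty. -/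
theorem stmt_8 {ε δ : Type*} [Fintype ε] [Fintype δ]
    (Tenv : Set (TotalStruct ε)) (Tsol : Set (TotalStruct ε × TotalStruct δ))
    (Sobs : PartialStruct ε) (Sdec : PartialStruct δ)
    (hcons : Consistent Tenv Tsol Sobs Sdec) :
    (∀ σ : ε, (Sobs σ).isSome → ∃ p ∈ MinDef Tenv Tsol Sobs Sdec, (p.1 σ).isSome) ∧
    (∀ σ : δ, (Sdec σ).isSome → ∃ p ∈ MinDef Tenv Tsol Sobs Sdec, (p.2 σ).isSome) ∧
    (MinDef Tenv Tsol Sobs Sdec).Nonempty := by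
  obtain ⟨p, hp⟩ := hcons.minDef_nonempty
  exact ⟨fun σ hσ => ⟨p, hp, hp.2.1.isSome hσ⟩, fun σ hσ => ⟨p, hp, hp.2.2.1.isSome hσ⟩, p, hp⟩
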